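/- arXiv:1105.6137 — 3 statements merged into one kernel-verified Lean document; each statement's English description precedes it below -/
import Mathlib

section
/- Let ω, η ∈ Ω± be such that K(ω) and K(η) have neither upper nor lower bounds, let K̄ = K(ω)×K(η), and let 𝒞 be the curve following map of τ_{ω,η}. Let (m,n) ∈ K̄ and v = (a,b) ∈ N, set s = ω_m·η_n and w = (sb,sa) ∈ N. Then R(m,n,v) = 2·E(m,n,w) − 1, where R(m,n,v) = min{j ≥ 1 : 𝒞^j((m,n),v) ∈ K̄×N} and E(m,n,w) = min{j ≥ 1 : (m,n)+j·w ∈ K̄}. -/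
/-- `Ω± = {1,−1}^ℤ` (signs modeled by `ℤˣ`). -/
abbrev Om : Type := ℤ → ℤˣ

/-- `N = {(1,0), (−1,0), (0,1), (0,−1)} ⊂ ℤ²`. -/
def Nset : Set (ℤ × ℤ) := {(1, 0), (-1, 0), (0, 1), (0, -1)}

/-- `K(ω) = {n : ¬(ω_n = −1 ∧ ω_{n+1} = 1) ∧ ¬(ω_{n−1} = −1 ∧ ω_n = 1)}`. -/
def Kset (ω : Om) : Set ℤ :=
  {n : ℤ | ¬(ω n = -1 ∧ ω (n+1) = 1) ∧ ¬(ω (n-1) = -1 ∧ ω n = 1)}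

/-- The curve following map of `τ : ℤ² → {1,−1}`:
`𝒞((m,n),(a,b)) = ((m+sb, n+sa), (sb,sa))` where `s = τ(m,n)`. -/
def curve (τ : ℤ × ℤ → ℤˣ) (p : (ℤ × ℤ) × (ℤ × ℤ)) : (ℤ × ℤ) × (ℤ × ℤ) :=
  ((p.1.1 + (τ p.1 : ℤ) * p.2.2, p.1.2 + (τ p.1 : ℤ) * p.2.1),
   ((τ p.1 : ℤ) * p.2.2, (τ p.1 : ℤ) * p.2.1))

/-- The two cells of a removed pair `-1, 1`, met while walking in direction `d`. -/
def PairAhead (ω : Om) (d : ℤˣ) (x : ℤ) : Prop := ω x = -d ∧ ω (x + d) = d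

theorem notMem_Kset_of_pairAhead {ω : Om} {d : ℤˣ} {x : ℤ} (h : PairAhead ω d x) :
    x ∉ Kset ω ∧ x + d ∉ Kset ω := by
  obtain ⟨h1, h2⟩ := h
  rcases Int.units_eq_one_or d with rfl | rfl <;> simp_all [Kset, ← sub_eq_add_neg]

theorem pairAhead_of_apply_eq {ω : Om} {d : ℤˣ} {x : ℤ} (hx : ω x = d) :
    x + d ∈ Kset ω ∨ PairAhead ω d (x + d) := by
  have h1 : x - 1 + 1 = x := by ring
  have h2 : x + 1 - 1 = x := by ring
  rw [or_iff_not_imp_left]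
  rcases Int.units_eq_one_or d with rfl | rfl <;>
    simp_all [Kset, PairAhead, ← sub_eq_add_neg]

theorem pairAhead_of_mem_Kset {ω : Om} {x : ℤ} (hx : x ∈ Kset ω) (d : ℤˣ) :
    x + d ∈ Kset ω ∨ PairAhead ω d (x + d) := by
  have h1 : x - 1 + 1 = x := by ring
  have h2 : x + 1 - 1 = x := by ring
  rw [or_iff_not_imp_left]
  rcases Int.units_eq_one_or d with rfl | rfl <;>
    rcases Int.units_eq_one_or (ω x) with h | h <;>
    simp_all [Kset, PairAhead, ← sub_eq_add_neg]

/-- The sign is constant across the side of a cell of `Kset η` that the curve crosses. -/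
theorem apply_sub_apply_of_mem_Kset {η : Om} {n : ℤ} (hn : n ∈ Kset η) :
    η (n - η n) = η n := by
  rcases Int.units_eq_one_or (η n) with h | h
  · rcases Int.units_eq_one_or (η (n - 1)) with h' | h' <;> simp_all [Kset]
  · rcases Int.units_eq_one_or (η (n + 1)) with h' | h' <;> simp_all [Kset]

/-- The curve goes around a removed pair in four steps. -/
theorem curve_around_pair {ω η : Om} {d : ℤˣ} {x n : ℤ} (hn : n ∈ Kset η)
    (h : PairAhead ω d x) :
    let c := curve (fun q => ω q.1 * η q.2)
    c ((x, n), ((d : ℤ), 0)) = ((x, n - η n), (0, -(η n : ℤ))) ∧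
    c ((x, n - η n), (0, -(η n : ℤ))) = ((x + d, n - η n), ((d : ℤ), 0)) ∧
    c ((x + d, n - η n), ((d : ℤ), 0)) = ((x + d, n), (0, (η n : ℤ))) ∧
    c ((x + d, n), (0, (η n : ℤ))) = ((x + 2 * d, n), ((d : ℤ), 0)) := by
  obtain ⟨h1, h2⟩ := h
  have h3 := apply_sub_apply_of_mem_Kset hn
  rcases Int.units_eq_one_or d with rfl | rfl <;>
    rcases Int.units_eq_one_or (η n) with h | h <;>
    simp_all [curve] <;> ring_nf <;> simp

theorem curve_iterate_horizontal {ω η : Om} (d : ℤˣ) {n : ℤ} (hn : n ∈ Kset η) (N : ℕ) :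
    ∀ x : ℤ, x + N * d ∈ Kset ω → (x ∈ Kset ω ∨ PairAhead ω d x) →
    ∃ k : ℕ, x + (2 * k : ℕ) * d ∈ Kset ω ∧ (∀ j < 2 * k, x + (j : ℕ) * d ∉ Kset ω) ∧
      (curve (fun q => ω q.1 * η q.2))^[4 * k] ((x, n), ((d : ℤ), 0)) =
        ((x + (2 * k : ℕ) * d, n), ((d : ℤ), 0)) ∧
      ∀ j < 4 * k,
        ((curve (fun q => ω q.1 * η q.2))^[j] ((x, n), ((d : ℤ), 0))).1.1 ∉ Kset ω := by
  induction N using Nat.strong_induction_on with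
  | _ N ih =>
  intro x hN hx
  rcases hx with hx | hx
  · exact ⟨0, by simpa using hx, by simp, by simp, by simp⟩
  obtain ⟨hx0, hx1⟩ := notMem_Kset_of_pairAhead hx
  obtain ⟨c1, c2, c3, c4⟩ := curve_around_pair hn hx
  match N, hN, ih with
  | 0, hN, _ => exact absurd (by simpa using hN) hx0
  | 1, hN, _ => exact absurd (by simpa using hN) hx1
  | N + 2, hN, ih =>
    have e2 : x + d + d = x + 2 * (d : ℤ) := by ring
    obtain ⟨k, k1, k2, k3, k4⟩ := ih N (by omega) (x + 2 * d)
      (by convert hN using 1; push_cast; ring) (e2 ▸ pairAhead_of_apply_eq hx.2)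
    have e3 : x + 2 * (d : ℤ) + (2 * k : ℕ) * d = x + (2 * (k + 1) : ℕ) * d := by
      push_cast; ring
    refine ⟨k + 1, e3 ▸ k1, ?_, ?_, ?_⟩
    · intro j hj
      match j, hj with
      | 0, _ => simpa using hx0
      | 1, _ => simpa using hx1
      | j + 2, hj =>
        convert k2 j (by omega) using 2
        push_cast; ring
    · rw [show 4 * (k + 1) = 4 * k + 4 by ring, ← e3, ← k3]
      simp only [Function.iterate_succ_apply, c1, c2, c3, c4]
    · intro j hj
      match j, hj with
      | 0, _ => simpa using hx0
      | 1, _ => simpa only [Function.iterate_one, c1] using hx0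
      | 2, _ => simpa only [Function.iterate_succ_apply, Function.iterate_zero_apply, c1, c2]
          using hx1
      | 3, _ => simpa only [Function.iterate_succ_apply, Function.iterate_zero_apply, c1, c2, c3]
          using hx1
      | j + 4, hj => simpa only [Function.iterate_succ_apply, c1, c2, c3, c4] using k4 j (by omega)

theorem exists_add_mul_mem {S : Set ℤ} (hS : ¬BddAbove S ∧ ¬BddBelow S) (x : ℤ) (d : ℤˣ) :
    ∃ N : ℕ, x + N * d ∈ S := by
  rcases Int.units_eq_one_or d with rfl | rfl
  · obtain ⟨y, hy, hxy⟩ := not_bddAbove_iff.1 hS.1 x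
    refine ⟨(y - x).toNat, ?_⟩
    rw [Int.toNat_of_nonneg (by omega)]
    simpa using hy
  · obtain ⟨y, hy, hxy⟩ := not_bddBelow_iff.1 hS.2 x
    refine ⟨(x - y).toNat, ?_⟩
    rw [Int.toNat_of_nonneg (by omega)]
    simpa using hy

theorem curve_return_of_vertical {ω η : Om} (hω : ¬BddAbove (Kset ω) ∧ ¬BddBelow (Kset ω))
    {m n : ℤ} (hm : m ∈ Kset ω) (hn : n ∈ Kset η) (b : ℤˣ) :
    ∃ e : ℕ, 1 ≤ e ∧ m + (e : ℤ) * (((ω m * η n : ℤˣ) : ℤ) * b) ∈ Kset ω ∧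
      (∀ j : ℕ, 1 ≤ j → j < e → m + (j : ℤ) * (((ω m * η n : ℤˣ) : ℤ) * b) ∉ Kset ω) ∧
      (∃ d : ℤˣ, (curve (fun q => ω q.1 * η q.2))^[2 * e - 1] ((m, n), (0, (b : ℤ))) =
        ((m + (e : ℤ) * (((ω m * η n : ℤˣ) : ℤ) * b), n), ((d : ℤ), 0))) ∧
      ∀ j : ℕ, 1 ≤ j → j < 2 * e - 1 →
        ((curve (fun q => ω q.1 * η q.2))^[j] ((m, n), (0, (b : ℤ)))).1.1 ∉ Kset ω := by
  obtain ⟨d, hd⟩ : ∃ d : ℤˣ, ((ω m * η n : ℤˣ) : ℤ) * b = d :=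
    ⟨ω m * η n * b, (Units.val_mul _ _).symm⟩
  have c0 : curve (fun q => ω q.1 * η q.2) ((m, n), (0, (b : ℤ))) = ((m + d, n), ((d : ℤ), 0)) := by
    simp only [curve, hd, mul_zero, add_zero]
  obtain ⟨N, hN⟩ := exists_add_mul_mem hω (m + d) d
  obtain ⟨k, k1, k2, k3, k4⟩ := curve_iterate_horizontal d hn N (m + d) hN
    (pairAhead_of_mem_Kset hm d)
  have shift (j : ℕ) : m + ((j + 1 : ℕ) : ℤ) * d = m + d + j * d := by push_cast; ring
  rw [hd]
  refine ⟨2 * k + 1, by omega, shift _ ▸ k1, ?_, ⟨d, ?_⟩, ?_⟩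
  · rintro (_ | j) h1 h2
    · omega
    · exact shift _ ▸ k2 j (by omega)
  · rw [show 2 * (2 * k + 1) - 1 = 4 * k + 1 by omega, Function.iterate_succ_apply, c0, k3, shift]
  · rintro (_ | j) h1 h2
    · omega
    · rw [Function.iterate_succ_apply, c0]
      exact k4 j (by omega)

theorem curve_iterate_swap (ω η : Om) (j : ℕ) (p : (ℤ × ℤ) × (ℤ × ℤ)) :
    (curve (fun q => ω q.1 * η q.2))^[j] (Prod.map Prod.swap Prod.swap p) =
      Prod.map Prod.swap Prod.swap ((curve (fun q => η q.1 * ω q.2))^[j] p) := by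
  have h : Function.Semiconj (Prod.map Prod.swap Prod.swap)
      (curve (fun q => η q.1 * ω q.2)) (curve (fun q => ω q.1 * η q.2)) := by
    rintro ⟨⟨x, y⟩, ⟨a, b⟩⟩
    simp [curve, mul_comm]
  exact ((h.iterate_right j) p).symm

theorem unit_mem_Nset (d : ℤˣ) : ((d : ℤ), 0) ∈ Nset ∧ (0, (d : ℤ)) ∈ Nset := by
  rcases Int.units_eq_one_or d with rfl | rfl <;> simp [Nset]

/-- Tiling return time, Theorem 4.3. Suppose `K(ω)` and `K(η)` are
unbounded above and below, `(m,n) ∈ K̄ = K(ω) × K(η)`, `v = (a,b) ∈ N`, `s = ω_m·η_n` and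
`w = (sb, sa)`. Then `R(m,n,v) = 2·E(m,n,w) − 1`: there is `e ≥ 1` which is the least
`j ≥ 1` with `(m,n) + j·w ∈ K̄`, and `2e − 1` is the least `j ≥ 1` with
`𝒞^j((m,n),v) ∈ K̄ × N`. -/
theorem tiling_return_time (ω η : Om)
    (hω : ¬BddAbove (Kset ω) ∧ ¬BddBelow (Kset ω))
    (hη : ¬BddAbove (Kset η) ∧ ¬BddBelow (Kset η))
    (m n : ℤ) (hm : m ∈ Kset ω) (hn : n ∈ Kset η)
    (a b : ℤ) (hv : (a, b) ∈ Nset) :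
    ∃ e : ℕ, 1 ≤ e ∧
      (m + (e : ℤ) * (((ω m * η n : ℤˣ) : ℤ) * b) ∈ Kset ω ∧
        n + (e : ℤ) * (((ω m * η n : ℤˣ) : ℤ) * a) ∈ Kset η) ∧
      (∀ j : ℕ, 1 ≤ j → j < e →
        ¬(m + (j : ℤ) * (((ω m * η n : ℤˣ) : ℤ) * b) ∈ Kset ω ∧
          n + (j : ℤ) * (((ω m * η n : ℤˣ) : ℤ) * a) ∈ Kset η)) ∧
      (((curve (fun q => ω q.1 * η q.2))^[2 * e - 1] ((m, n), (a, b))).1.1 ∈ Kset ω ∧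
        ((curve (fun q => ω q.1 * η q.2))^[2 * e - 1] ((m, n), (a, b))).1.2 ∈ Kset η ∧
        ((curve (fun q => ω q.1 * η q.2))^[2 * e - 1] ((m, n), (a, b))).2 ∈ Nset) ∧
      (∀ j : ℕ, 1 ≤ j → j < 2 * e - 1 →
        ¬(((curve (fun q => ω q.1 * η q.2))^[j] ((m, n), (a, b))).1.1 ∈ Kset ω ∧
          ((curve (fun q => ω q.1 * η q.2))^[j] ((m, n), (a, b))).1.2 ∈ Kset η ∧
          ((curve (fun q => ω q.1 * η q.2))^[j] ((m, n), (a, b))).2 ∈ Nset)) := by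
  have hv' : (a = 0 ∧ ∃ u : ℤˣ, b = u) ∨ (b = 0 ∧ ∃ u : ℤˣ, a = u) := by
    simp only [Nset, Set.mem_insert_iff, Set.mem_singleton_iff, Prod.mk.injEq] at hv
    rcases hv with ⟨rfl, rfl⟩ | ⟨rfl, rfl⟩ | ⟨rfl, rfl⟩ | ⟨rfl, rfl⟩
    · exact Or.inr ⟨rfl, 1, rfl⟩
    · exact Or.inr ⟨rfl, -1, rfl⟩
    · exact Or.inl ⟨rfl, 1, rfl⟩
    · exact Or.inl ⟨rfl, -1, rfl⟩
  rcases hv' with ⟨rfl, u, rfl⟩ | ⟨rfl, u, rfl⟩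
  · obtain ⟨e, e1, e2, e3, ⟨d, e4⟩, e5⟩ := curve_return_of_vertical hω hm hn u
    refine ⟨e, e1, ⟨e2, by simpa using hn⟩, fun j h1 h2 h => e3 j h1 h2 h.1, ?_,
      fun j h1 h2 h => e5 j h1 h2 h.1⟩
    rw [e4]
    exact ⟨e2, hn, (unit_mem_Nset d).1⟩
  · obtain ⟨e, e1, e2, e3, ⟨d, e4⟩, e5⟩ := curve_return_of_vertical hη hn hm u
    have hs (j : ℕ) := curve_iterate_swap ω η j ((n, m), (0, (u : ℤ)))
    simp only [Prod.map_apply, Prod.swap_prod_mk] at hs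
    rw [mul_comm (η n)] at e2 e3 e4
    refine ⟨e, e1, ⟨by simpa using hm, e2⟩, fun j h1 h2 h => e3 j h1 h2 h.2, ?_, ?_⟩
    · rw [hs, e4]
      exact ⟨hm, e2, (unit_mem_Nset d).2⟩
    · intro j h1 h2 h
      rw [hs] at h
      exact e5 j h1 h2 h.2.1
end

section
/- If (ω,η,v) ∈ X is periodic under Φ (i.e. Φᵏ(ω,η,v) = (ω,η,v) for some k ≥ 1) but does not have a stable periodic orbit, then either ω is periodic under the shift σ or η is periodic under σ. -/
/-- `X = Ω± × Ω± × N`. -/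
abbrev XSp : Type := Om × Om × (ℤ × ℤ)

/-- `σ^k`: the `k`-th power of the shift map, `(σ^k ω)_n = ω_{n+k}`. -/
def shiftBy (k : ℤ) (ω : Om) : Om := fun n => ω (n + k)

/-- The map `Φ : X → X`, `Φ(ω, η, (a,b)) = (σ^{sb}(ω), σ^{sa}(η), (sb, sa))` where
`s = ω₀·η₀`. -/
def Phi (p : XSp) : XSp :=
  (shiftBy (((p.1 0 * p.2.1 0 : ℤˣ) : ℤ) * p.2.2.2) p.1,
   shiftBy (((p.1 0 * p.2.1 0 : ℤˣ) : ℤ) * p.2.2.1) p.2.1,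
   (((p.1 0 * p.2.1 0 : ℤˣ) : ℤ) * p.2.2.2, ((p.1 0 * p.2.1 0 : ℤˣ) : ℤ) * p.2.2.1))

/-- The point `x = (ω,η,v)` is fixed by `Φⁿ` stably: there are open neighborhoods `U ∋ ω`,
`V ∋ η` such that `Φⁿ(ω2,η2,v) = (ω2,η2,v)` for all `ω2 ∈ U`, `η2 ∈ V`. -/
def stablyFixedBy (x : XSp) (n : ℕ) : Prop :=
  ∃ U V : Set Om, IsOpen U ∧ IsOpen V ∧ x.1 ∈ U ∧ x.2.1 ∈ V ∧
    ∀ ω2 ∈ U, ∀ η2 ∈ V, Phi^[n] (ω2, η2, x.2.2) = (ω2, η2, x.2.2)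

/-- `x` has a stable periodic orbit of period `n`: `n` is the smallest positive integer
such that `x` is stably fixed by `Φⁿ`. -/
def hasStablePeriodicOrbitOfPeriod (x : XSp) (n : ℕ) : Prop :=
  0 < n ∧ stablyFixedBy x n ∧ ∀ m : ℕ, 0 < m → stablyFixedBy x m → n ≤ m

/-- `x` has a stable periodic orbit (of some period). -/
def hasStablePeriodicOrbit (x : XSp) : Prop :=
  ∃ n : ℕ, hasStablePeriodicOrbitOfPeriod x n

theorem shiftBy_zero (ω : Om) : shiftBy 0 ω = ω := by
  funext n
  simp [shiftBy]

theorem shiftBy_shiftBy (a b : ℤ) (ω : Om) : shiftBy a (shiftBy b ω) = shiftBy (a + b) ω := by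
  funext n
  simp [shiftBy, add_assoc]

theorem exists_pos_shiftBy_eq_self {ω : Om} {a : ℤ} (ha : a ≠ 0) (h : shiftBy a ω = ω) :
    ∃ k : ℕ, 1 ≤ k ∧ shiftBy (k : ℤ) ω = ω := by
  refine ⟨a.natAbs, Int.natAbs_pos.mpr ha, ?_⟩
  rcases Int.natAbs_eq a with hpos | hneg
  · rwa [← hpos]
  · have hnat : (a.natAbs : ℤ) = -a := by omega
    rw [hnat]
    nth_rewrite 1 [← h]
    rw [shiftBy_shiftBy, neg_add_cancel, shiftBy_zero]

/-- Near a given point with fixed direction, every iterate of `Phi` acts by constant shifts. -/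
theorem Phi_iterate_eq_shiftBy_near (ω η : Om) (v : ℤ × ℤ) (n : ℕ) :
    ∃ (A B : ℤ) (w : ℤ × ℤ) (U V : Set Om), IsOpen U ∧ IsOpen V ∧ ω ∈ U ∧ η ∈ V ∧
      ∀ ω2 ∈ U, ∀ η2 ∈ V, Phi^[n] (ω2, η2, v) = (shiftBy A ω2, shiftBy B η2, w) := by
  induction n with
  | zero =>
    exact ⟨0, 0, v, Set.univ, Set.univ, isOpen_univ, isOpen_univ, trivial, trivial,
      fun ω2 _ η2 _ => by simp [shiftBy_zero]⟩
  | succ n ih =>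
    obtain ⟨A, B, w, U, V, hU, hV, hωU, hηV, hUV⟩ := ih
    have hopen (c : ℤ) (ξ : Om) : IsOpen {ζ : Om | ζ c = ξ c} :=
      (isOpen_discrete {ξ c}).preimage (f := fun ζ : Om => ζ c) (continuous_apply c)
    refine ⟨((ω A * η B : ℤˣ) : ℤ) * w.2 + A, ((ω A * η B : ℤˣ) : ℤ) * w.1 + B,
      (((ω A * η B : ℤˣ) : ℤ) * w.2, ((ω A * η B : ℤˣ) : ℤ) * w.1),
      U ∩ {ζ | ζ A = ω A}, V ∩ {ζ | ζ B = η B}, hU.inter (hopen A ω), hV.inter (hopen B η),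
      ⟨hωU, rfl⟩, ⟨hηV, rfl⟩, ?_⟩
    rintro ω2 ⟨hω2, hωA⟩ η2 ⟨hη2, hηB⟩
    have hωA' : shiftBy A ω2 0 = ω A := by simpa [shiftBy] using hωA
    have hηB' : shiftBy B η2 0 = η B := by simpa [shiftBy] using hηB
    rw [Function.iterate_succ_apply', hUV ω2 hω2 η2 hη2]
    simp only [Phi, hωA', hηB', shiftBy_shiftBy]

theorem hasStablePeriodicOrbit_of_stablyFixedBy {x : XSp} {n : ℕ} (hn : 0 < n)
    (h : stablyFixedBy x n) : hasStablePeriodicOrbit x := by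
  classical
  have hex : ∃ m : ℕ, 0 < m ∧ stablyFixedBy x m := ⟨n, hn, h⟩
  exact ⟨Nat.find hex, (Nat.find_spec hex).1, (Nat.find_spec hex).2,
    fun m hm hmx => Nat.find_min' hex ⟨hm, hmx⟩⟩

/-- Stability Proposition, part 2. If `(ω,η,v) ∈ X` is periodic under
`Φ` but does not have a stable periodic orbit, then `ω` or `η` is periodic under the
shift. -/
theorem periodic_not_stable_implies_shift_periodic (ω η : Om) (v : ℤ × ℤ)
    (hv : v ∈ Nset)
    (hper : ∃ k : ℕ, 1 ≤ k ∧ Phi^[k] (ω, η, v) = (ω, η, v))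
    (hns : ¬ hasStablePeriodicOrbit (ω, η, v)) :
    (∃ k : ℕ, 1 ≤ k ∧ shiftBy (k : ℤ) ω = ω) ∨
    (∃ k : ℕ, 1 ≤ k ∧ shiftBy (k : ℤ) η = η) := by
  obtain ⟨k, hk, hfix⟩ := hper
  obtain ⟨A, B, w, U, V, hU, hV, hωU, hηV, hUV⟩ := Phi_iterate_eq_shiftBy_near ω η v k
  have hxk := hUV ω hωU η hηV
  rw [hfix, Prod.mk.injEq, Prod.mk.injEq] at hxk
  obtain ⟨hA, hB, hw⟩ := hxk
  by_cases hA0 : A = 0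
  · by_cases hB0 : B = 0
    · refine absurd (hasStablePeriodicOrbit_of_stablyFixedBy hk
        ⟨U, V, hU, hV, hωU, hηV, fun ω2 hω2 η2 hη2 => ?_⟩) hns
      rw [hUV ω2 hω2 η2 hη2, hA0, hB0, ← hw, shiftBy_zero, shiftBy_zero]
    · exact Or.inr (exists_pos_shiftBy_eq_self hB0 hB.symm)
  · exact Or.inl (exists_pos_shiftBy_eq_self hA0 hA.symm)
end

section
/- Let α ∈ [0,1/2) and C_α = [α,1−α) ⊂ ℝ/ℤ. For Lebesgue-almost every x ∈ C_α (identified with its representative in [α,1−α)), the first return time of T_α to C_α at x equals 2·⌊x/(1−2α)⌋ + 1, and the first return time of T_α⁻¹ (the rotation by −α) to C_α at x equals 2·⌊(1−x)/(1−2α)⌋ + 1; here the first return time of F to S at p ∈ S is min{k ≥ 1 : F^k(p) ∈ S}, and ⌊t⌋ denotes the greatest integer ≤ t. -/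
open MeasureTheory
open scoped Classical

/-- The circle `ℝ/ℤ`. -/
noncomputable abbrev T1 : Type := AddCircle (1:ℝ)

/-- The canonical representative in `[0,1)` of a point of `ℝ/ℤ`. -/
noncomputable def rep1 (x : T1) : ℝ := (AddCircle.equivIco 1 0 x : ℝ)

/-- The rotation `T_α : ℝ/ℤ → ℝ/ℤ`, `x ↦ x + α (mod 1)`. -/
noncomputable def rot (α : ℝ) (x : T1) : T1 := x + (α : T1)

lemma fract_mem_Ico_of_sub_mem {α y : ℝ} (h0 : 0 ≤ α) (n : ℤ)
    (h : y - n ∈ Set.Ico α (1 - α)) : Int.fract y ∈ Set.Ico α (1 - α) := by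
  have hy : Int.fract y = y - n :=
    Int.fract_eq_iff.2 ⟨by linarith [h.1], by linarith [h.2], n, by ring⟩
  rwa [hy]

lemma fract_notMem_Ico_of_sub_mem {α y : ℝ} (n : ℤ)
    (h : y - n ∈ Set.Ico (1 - α) (1 + α)) : Int.fract y ∉ Set.Ico α (1 - α) := by
  rintro ⟨hl, hr⟩
  have hy := Int.floor_add_fract y
  have hpos : n < ⌊y⌋ := by
    have : (n : ℝ) < ⌊y⌋ := by linarith [h.1]
    exact_mod_cast this
  have hlt : ⌊y⌋ < n + 1 := by
    have : (⌊y⌋ : ℝ) < n + 1 := by linarith [h.2]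
    exact_mod_cast this
  omega

lemma rep1_coe (y : ℝ) : rep1 (y : T1) = Int.fract y :=
  (AddCircle.coe_equivIco_mk_apply 1 y).trans (by simp)

lemma coe_rep1 (x : T1) : ((rep1 x : ℝ) : T1) = x :=
  (AddCircle.equivIco 1 0).symm_apply_apply x

lemma rot_iterate (a : ℝ) (j : ℕ) (x : T1) : (rot a)^[j] x = x + ((j * a : ℝ) : T1) := by
  induction j with
  | zero => simp
  | succ k ih =>
    rw [Function.iterate_succ_apply', ih, rot, add_assoc, ← AddCircle.coe_add]
    push_cast
    ring_nf

lemma rep1_rot_iterate (a : ℝ) (j : ℕ) (x : T1) :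
    rep1 ((rot a)^[j] x) = Int.fract (rep1 x + j * a) := by
  rw [← rep1_coe, AddCircle.coe_add, coe_rep1, rot_iterate]

/-- If `x - m (1 - 2α)` lies in `[0, 1 - 2α)`, the first return of `x` under `T_α` is at time
`2m + 1`. -/
lemma fract_add_return {α x : ℝ} (h0 : 0 ≤ α) (h1 : α < 1 / 2) (hx : x ∈ Set.Ico α (1 - α))
    (m : ℕ) (hm : m * (1 - 2 * α) ≤ x) (hm' : x < (m + 1) * (1 - 2 * α)) :
    Int.fract (x + (2 * m + 1 : ℕ) * α) ∈ Set.Ico α (1 - α) ∧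
      ∀ j : ℕ, 1 ≤ j → j < 2 * m + 1 → Int.fract (x + j * α) ∉ Set.Ico α (1 - α) := by
  obtain ⟨hl, hr⟩ := hx
  refine ⟨fract_mem_Ico_of_sub_mem h0 m ?_, fun j hj hjm => ?_⟩
  · push_cast
    constructor <;> linarith
  obtain ⟨i, rfl | rfl⟩ := Nat.even_or_odd' j
  · have hi : (1 : ℝ) ≤ i := by exact_mod_cast (by omega : 1 ≤ i)
    have him : (i : ℝ) ≤ m := by exact_mod_cast (by omega : i ≤ m)
    refine fract_notMem_Ico_of_sub_mem (i - 1) ?_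
    push_cast
    constructor <;> nlinarith
  · have hi : (0 : ℝ) ≤ i := i.cast_nonneg
    have him : (i : ℝ) + 1 ≤ m := by exact_mod_cast (by omega : i + 1 ≤ m)
    refine fract_notMem_Ico_of_sub_mem i ?_
    push_cast
    constructor <;> nlinarith

/-- If `x + m (1 - 2α)` lies in `(2α, 1)`, the first return of `x` under `T_{-α}` is at time
`2m + 1`. -/
lemma fract_sub_return {α x : ℝ} (h0 : 0 ≤ α) (h1 : α < 1 / 2) (hx : x ∈ Set.Ico α (1 - α))
    (m : ℕ) (hm : m * (1 - 2 * α) < 1 - x) (hm' : 1 - x < (m + 1) * (1 - 2 * α)) :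
    Int.fract (x + (2 * m + 1 : ℕ) * -α) ∈ Set.Ico α (1 - α) ∧
      ∀ j : ℕ, 1 ≤ j → j < 2 * m + 1 → Int.fract (x + j * -α) ∉ Set.Ico α (1 - α) := by
  obtain ⟨hl, hr⟩ := hx
  refine ⟨fract_mem_Ico_of_sub_mem h0 (-m) ?_, fun j hj hjm => ?_⟩
  · push_cast
    constructor <;> linarith
  obtain ⟨i, rfl | rfl⟩ := Nat.even_or_odd' j
  · have hi : (1 : ℝ) ≤ i := by exact_mod_cast (by omega : 1 ≤ i)
    have him : (i : ℝ) ≤ m := by exact_mod_cast (by omega : i ≤ m)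
    refine fract_notMem_Ico_of_sub_mem (-i) ?_
    push_cast
    constructor <;> nlinarith
  · have hi : (0 : ℝ) ≤ i := i.cast_nonneg
    have him : (i : ℝ) + 1 ≤ m := by exact_mod_cast (by omega : i + 1 ≤ m)
    refine fract_notMem_Ico_of_sub_mem (-i - 1) ?_
    push_cast
    constructor <;> nlinarith

/-- For `t ≥ 0` the time `2⌊t/d⌋ + 1` is `2m + 1` with `m d ≤ t < (m + 1) d`. -/
lemma exists_toNat_two_mul_floor_add_one {t d : ℝ} (ht : 0 ≤ t) (hd : 0 < d) :
    ∃ m : ℕ, (2 * ⌊t / d⌋ + 1).toNat = 2 * m + 1 ∧ m * d ≤ t ∧ t < (m + 1) * d := by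
  have hfloor := Int.natCast_floor_eq_floor (div_nonneg ht hd.le)
  refine ⟨⌊t / d⌋₊, by omega, ?_, ?_⟩
  · exact (le_div_iff₀ hd).1 (Nat.floor_le (div_nonneg ht hd.le))
  · exact (div_lt_iff₀ hd).1 (Nat.lt_floor_add_one _)

instance nullSingletonClass_volume_addCircle (T : ℝ) [Fact (0 < T)] :
    NullSingletonClass (volume : Measure (AddCircle T)) where
  measure_singleton x := by
    rw [← Metric.closedBall_zero, AddCircle.volume_closedBall]
    simp

lemma ae_one_sub_rep1_ne (d : ℝ) : ∀ᵐ x : T1, ∀ m : ℕ, m * d ≠ 1 - rep1 x := by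
  have hc : (Set.range fun m : ℕ => ((1 - m * d : ℝ) : T1)).Countable := Set.countable_range _
  filter_upwards [hc.ae_notMem volume] with x hx m hm
  refine hx ⟨m, ?_⟩
  rw [← coe_rep1 x]
  exact congrArg _ (by linarith)

/-- Rotation return times. Let `α ∈ [0,1/2)` and
`C_α = [α,1−α) ⊂ ℝ/ℤ`. For Lebesgue-almost every `x ∈ C_α` (identified with its
representative in `[α,1−α)`), the first return time of `T_α` to `C_α` at `x` equals
`2·⌊x/(1−2α)⌋ + 1`, and the first return time of `T_α⁻¹ = T_{−α}` to `C_α` at `x` equals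
`2·⌊(1−x)/(1−2α)⌋ + 1`. -/
theorem rotation_return_times (α : ℝ) (h0 : 0 ≤ α) (h1 : α < 1/2) :
    ∀ᵐ x : T1 ∂(volume : Measure T1), rep1 x ∈ Set.Ico α (1 - α) →
      (rep1 ((rot α)^[(2 * ⌊rep1 x / (1 - 2*α)⌋ + 1).toNat] x) ∈ Set.Ico α (1 - α) ∧
        ∀ j : ℕ, 1 ≤ j → j < (2 * ⌊rep1 x / (1 - 2*α)⌋ + 1).toNat →
          rep1 ((rot α)^[j] x) ∉ Set.Ico α (1 - α)) ∧
      (rep1 ((rot (-α))^[(2 * ⌊(1 - rep1 x) / (1 - 2*α)⌋ + 1).toNat] x) ∈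
          Set.Ico α (1 - α) ∧
        ∀ j : ℕ, 1 ≤ j → j < (2 * ⌊(1 - rep1 x) / (1 - 2*α)⌋ + 1).toNat →
          rep1 ((rot (-α))^[j] x) ∉ Set.Ico α (1 - α)) := by
  filter_upwards [ae_one_sub_rep1_ne (1 - 2 * α)] with x hne hx
  have hd : 0 < 1 - 2 * α := by linarith
  obtain ⟨m, hm, hml, hmr⟩ :=
    exists_toNat_two_mul_floor_add_one (h0.trans hx.1) hd
  obtain ⟨n, hn, hnl, hnr⟩ :=
    exists_toNat_two_mul_floor_add_one (by linarith [hx.2] : 0 ≤ 1 - rep1 x) hd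
  simp only [hm, hn, rep1_rot_iterate]
  exact ⟨fract_add_return h0 h1 hx m hml hmr,
    fract_sub_return h0 h1 hx n (lt_of_le_of_ne hnl (hne n)) hnr⟩
end
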